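/- arXiv:2601.13256 — 3 statements merged into one kernel-verified Lean document; each statement's English description precedes it below -/
import Mathlib

section
/- Let d ≥ 1, σ > 0, let γ be the Gaussian measure N(0, σ² I_d) on ℝ^d (the d-fold product of the centered Gaussian measure of variance σ² on ℝ), and let f : ℝ^d → ℝ be bounded and measurable. Define u(x) := ∫ f(x + δ) dγ(δ). Then u is twice differentiable at every x ∈ ℝ^d and its second-order partial derivatives are given by ∂²u/∂x_i∂x_j (x) = (1/σ⁴) ∫ (δ_i δ_j − σ² δ_{ij}) f(x + δ) dγ(δ) for all i, j, where δ_{ij} is the Kronecker delta. -/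
open MeasureTheory ProbabilityTheory

section LaplaceTransform

variable {E : Type*} [NormedAddCommGroup E] [MeasurableSpace E]

/-- The function `g` stays `μ`-integrable after multiplication by any exponential of the norm. -/
def ExpIntegrable (μ : Measure E) (g : E → ℝ) : Prop :=
  ∀ R : ℝ, Integrable (fun y => Real.exp (R * ‖y‖) * g y) μ

namespace ExpIntegrable

variable {μ : Measure E} {g : E → ℝ}

lemma integrable (hg : ExpIntegrable μ g) : Integrable g μ := by
  simpa using hg 0

variable [NormedSpace ℝ E] [BorelSpace E]

lemma exp_clm_mul (hg : ExpIntegrable μ g) (L : E →L[ℝ] ℝ) :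
    Integrable (fun y => Real.exp (L y) * g y) μ := by
  refine (hg ‖L‖).mono ((by fun_prop : Measurable fun y => Real.exp (L y)).aestronglyMeasurable.mul
    hg.integrable.aestronglyMeasurable) (.of_forall fun y => ?_)
  simp only [norm_mul, Real.norm_eq_abs, Real.abs_exp]
  gcongr
  exact (le_abs_self _).trans (L.le_opNorm y)

lemma clm_mul (hg : ExpIntegrable μ g) (L : E →L[ℝ] ℝ) :
    ExpIntegrable μ (fun y => L y * g y) := by
  intro R
  refine ((hg (R + 1)).const_mul ‖L‖).mono
    (((by fun_prop : Measurable fun y : E => Real.exp (R * ‖y‖)).aestronglyMeasurable).mul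
    (L.continuous.measurable.aestronglyMeasurable.mul hg.integrable.aestronglyMeasurable))
    (.of_forall fun y => ?_)
  have h1 : ‖L y‖ ≤ ‖L‖ * Real.exp ‖y‖ := (L.le_opNorm y).trans (by
    gcongr; linarith [Real.add_one_le_exp ‖y‖])
  simp only [norm_mul, Real.norm_eq_abs, Real.abs_exp, abs_norm] at h1 ⊢
  calc Real.exp (R * ‖y‖) * (|L y| * |g y|)
      ≤ Real.exp (R * ‖y‖) * (‖L‖ * Real.exp ‖y‖ * |g y|) := by gcongr
    _ = ‖L‖ * (Real.exp ((R + 1) * ‖y‖) * |g y|) := by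
      rw [add_mul, Real.exp_add, one_mul]; ring

variable [SecondCountableTopology E]

/-- Differentiation under the integral sign for a Laplace transform. -/
lemma hasFDerivAt_laplace (hg : ExpIntegrable μ g) (B : E →L[ℝ] E →L[ℝ] ℝ) (x : E) :
    Integrable (fun y => (Real.exp (B y x) * g y) • B y) μ ∧
    HasFDerivAt (fun z => ∫ y, Real.exp (B y z) * g y ∂μ)
      (∫ y, (Real.exp (B y x) * g y) • B y ∂μ) x := by
  have hmeas (z : E) : AEStronglyMeasurable (fun y => Real.exp (B y z) * g y) μ :=
    (hg.exp_clm_mul (B.flip z)).aestronglyMeasurable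
  have hmeas' : AEStronglyMeasurable (fun y => (Real.exp (B y x) * g y) • B y) μ :=
    (hmeas x).smul B.continuous.aestronglyMeasurable
  set bound : E → ℝ := fun y => ‖B‖ * ‖Real.exp ((‖B‖ * (‖x‖ + 1) + 1) * ‖y‖) * g y‖ with hbound
  have hbi : Integrable bound μ := ((hg _).norm).const_mul _
  have hle : ∀ y, ∀ z ∈ Metric.ball x 1, ‖(Real.exp (B y z) * g y) • B y‖ ≤ bound y := by
    intro y z hz
    have hz' : ‖z‖ ≤ ‖x‖ + 1 := by
      have := norm_le_norm_add_norm_sub x z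
      rw [mem_ball_iff_norm'] at hz
      linarith
    have h1 : B y z ≤ ‖B‖ * (‖x‖ + 1) * ‖y‖ := calc
      B y z ≤ ‖B‖ * ‖y‖ * ‖z‖ := (le_abs_self _).trans (B.le_opNorm₂ y z)
      _ ≤ ‖B‖ * ‖y‖ * (‖x‖ + 1) := by gcongr
      _ = _ := by ring
    have h2 : ‖B y‖ ≤ ‖B‖ * Real.exp ‖y‖ := (B.le_opNorm y).trans (by
      gcongr; linarith [Real.add_one_le_exp ‖y‖])
    simp only [hbound, norm_smul, norm_mul, Real.norm_eq_abs, Real.abs_exp]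
    calc Real.exp (B y z) * |g y| * ‖B y‖
        ≤ Real.exp (‖B‖ * (‖x‖ + 1) * ‖y‖) * |g y| * (‖B‖ * Real.exp ‖y‖) := by gcongr
      _ = _ := by rw [add_mul _ 1 ‖y‖, Real.exp_add, one_mul]; ring
  refine ⟨hbi.mono' hmeas' (.of_forall fun y => hle y x (Metric.mem_ball_self one_pos)), ?_⟩
  refine hasFDerivAt_integral_of_dominated_of_fderiv_le (Metric.ball_mem_nhds x one_pos)
    (.of_forall hmeas) (hg.exp_clm_mul (B.flip x)) hmeas' (.of_forall hle) hbi
    (.of_forall fun y z _ => ?_)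
  have := ((B y).hasFDerivAt (x := z)).exp.mul_const (g y)
  rwa [smul_smul, mul_comm (g y)] at this

end ExpIntegrable

end LaplaceTransform

open scoped ENNReal NNReal

lemma MeasureTheory.Measure.pi_withDensity {ι : Type*} [Fintype ι] {X : ι → Type*}
    [∀ i, MeasurableSpace (X i)] (μ : ∀ i, Measure (X i)) [∀ i, IsProbabilityMeasure (μ i)]
    (ρ : ∀ i, X i → ℝ≥0∞) (hρ : ∀ i, Measurable (ρ i))
    [∀ i, SigmaFinite ((μ i).withDensity (ρ i))] :
    Measure.pi (fun i => (μ i).withDensity (ρ i))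
      = (Measure.pi μ).withDensity fun y => ∏ i, ρ i (y i) := by
  refine Measure.pi_eq fun s hs => ?_
  have hind (y : ∀ i, X i) : (Set.univ.pi s).indicator (fun y => ∏ i, ρ i (y i)) y
      = ∏ i, (s i).indicator (ρ i) (y i) := by
    by_cases hy : y ∈ Set.univ.pi s
    · rw [Set.indicator_of_mem hy]
      exact Finset.prod_congr rfl fun i _ => (Set.indicator_of_mem (hy i trivial) _).symm
    · rw [Set.indicator_of_notMem hy]
      simp only [Set.mem_pi, Set.mem_univ, true_imp_iff, not_forall] at hy
      obtain ⟨i, hi⟩ := hy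
      exact (Finset.prod_eq_zero (Finset.mem_univ i) (Set.indicator_of_notMem hi _)).symm
  have hm (i : ι) : Measurable ((s i).indicator (ρ i)) := (hρ i).indicator (hs i)
  rw [withDensity_apply _ (.univ_pi hs), ← lintegral_indicator (.univ_pi hs),
    lintegral_congr hind, lintegral_prod_eq_prod_lintegral_of_indepFun Finset.univ
      (fun i (y : ∀ i, X i) => (s i).indicator (ρ i) (y i))
      (iIndepFun_pi fun i => (hm i).aemeasurable) fun i => (hm i).comp (measurable_pi_apply i)]
  refine Finset.prod_congr rfl fun i _ => ?_
  rw [withDensity_apply _ (hs i), ← lintegral_indicator (hs i)]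
  exact (measurePreserving_eval μ i).lintegral_comp (hm i)

lemma gaussianReal_eq_withDensity_gaussianReal_zero (m : ℝ) {v : ℝ≥0} (hv : v ≠ 0) :
    gaussianReal m v = (gaussianReal 0 v).withDensity
      fun y => ENNReal.ofReal (Real.exp (m * y / v - m ^ 2 / (2 * v))) := by
  rw [gaussianReal_of_var_ne_zero _ hv, gaussianReal_of_var_ne_zero _ hv,
    ← withDensity_mul _ (measurable_gaussianPDF 0 v) (by fun_prop)]
  congr 1
  ext y
  have hv' : (v : ℝ) ≠ 0 := by exact_mod_cast hv
  simp only [Pi.mul_apply, gaussianPDF]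
  rw [← ENNReal.ofReal_mul (gaussianPDFReal_nonneg _ _ _)]
  simp only [gaussianPDFReal, mul_assoc]
  rw [← Real.exp_add]
  congr 4
  field_simp
  ring

section GaussianSmoothing

variable {ι : Type*} [Fintype ι] {v : ℝ≥0}

/-- The Cameron–Martin formula for a product of centered Gaussian measures of variance `v`. -/
lemma map_const_add_pi_gaussianReal (hv : v ≠ 0) (x : ι → ℝ) :
    (Measure.pi fun _ : ι => gaussianReal 0 v).map (x + ·)
      = (Measure.pi fun _ : ι => gaussianReal 0 v).withDensity fun y =>
        ENNReal.ofReal (Real.exp ((v : ℝ)⁻¹ * ∑ i, y i * x i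
          - (v : ℝ)⁻¹ * (∑ i, x i ^ 2) / 2)) := by
  have h1 : (Measure.pi fun _ : ι => gaussianReal 0 v).map (x + ·)
      = Measure.pi fun i => gaussianReal (x i) v := by
    have := Measure.pi_map_pi (μ := fun _ : ι => gaussianReal 0 v)
      (f := fun i t => x i + t) (hμ := fun i => by
        rw [gaussianReal_map_const_add]; infer_instance) fun i => by fun_prop
    simp only [gaussianReal_map_const_add, zero_add] at this
    exact this
  have hs (i : ι) := gaussianReal_eq_withDensity_gaussianReal_zero (x i) hv
  have (i : ι) : SigmaFinite ((gaussianReal 0 v).withDensity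
      fun y => ENNReal.ofReal (Real.exp (x i * y / v - x i ^ 2 / (2 * v)))) := by
    rw [← hs]; infer_instance
  rw [h1, funext hs, Measure.pi_withDensity _ _ fun i => by fun_prop]
  congr 1
  ext y
  rw [← ENNReal.ofReal_prod_of_nonneg fun i _ => (Real.exp_pos _).le, ← Real.exp_sum]
  congr 2
  rw [Finset.mul_sum, Finset.mul_sum, Finset.sum_div, ← Finset.sum_sub_distrib]
  have hv' : (v : ℝ) ≠ 0 := by exact_mod_cast hv
  refine Finset.sum_congr rfl fun i _ => ?_
  field_simp

lemma expIntegrable_pi_gaussianReal_of_bounded {f : (ι → ℝ) → ℝ} (hfm : Measurable f) {M : ℝ}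
    (hfb : ∀ y, |f y| ≤ M) : ExpIntegrable (Measure.pi fun _ : ι => gaussianReal 0 v) f := by
  intro R
  have hone (i : ι) : Integrable (fun t => Real.exp (|R| * |t|)) (gaussianReal 0 v) :=
    integrable_exp_mul_abs (integrable_exp_mul_gaussianReal _) (integrable_exp_mul_gaussianReal _)
  refine ((Integrable.fintype_prod hone).mul_const M).mono' (by fun_prop) (.of_forall fun y => ?_)
  rw [← Real.exp_sum, ← Finset.mul_sum, norm_mul, Real.norm_eq_abs, Real.abs_exp]
  gcongr
  · exact le_abs_self R
  · exact (pi_norm_le_iff_of_nonneg (by positivity)).2 fun i =>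
      Finset.single_le_sum (f := fun i => |y i|) (fun i _ => abs_nonneg _) (Finset.mem_univ i)
  · exact hfb y

variable {g : (ι → ℝ) → ℝ}

/-- The scalar product divided by `v`, as a continuous bilinear form. -/
noncomputable def scaledDot (ι : Type*) [Fintype ι] (v : ℝ≥0) : (ι → ℝ) →L[ℝ] (ι → ℝ) →L[ℝ] ℝ :=
  (v : ℝ)⁻¹ • ∑ i, (ContinuousLinearMap.proj (R := ℝ) (φ := fun _ : ι => ℝ) i).smulRight
    (ContinuousLinearMap.proj (R := ℝ) (φ := fun _ : ι => ℝ) i)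

lemma scaledDot_apply (y x : ι → ℝ) : scaledDot ι v y x = (v : ℝ)⁻¹ * ∑ i, y i * x i := by
  simp [scaledDot]

lemma integrable_comp_add_pi_gaussianReal (hv : v ≠ 0)
    (hg : ExpIntegrable (Measure.pi fun _ : ι => gaussianReal 0 v) g) (x : ι → ℝ) :
    Integrable (fun δ => g (x + δ)) (Measure.pi fun _ : ι => gaussianReal 0 v) := by
  have h : Integrable g ((Measure.pi fun _ : ι => gaussianReal 0 v).map (x + ·)) := by
    rw [map_const_add_pi_gaussianReal hv, integrable_withDensity_iff_integrable_smul' (by fun_prop)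
      (.of_forall fun _ => ENNReal.ofReal_lt_top)]
    refine ((hg.exp_clm_mul ((scaledDot ι v).flip x)).const_mul
      (Real.exp (-((v : ℝ)⁻¹ * (∑ i, x i ^ 2) / 2)))).congr (.of_forall fun y => ?_)
    dsimp only
    rw [ENNReal.toReal_ofReal (Real.exp_pos _).le]
    simp only [smul_eq_mul, ContinuousLinearMap.flip_apply, scaledDot_apply, sub_eq_add_neg, Real.exp_add]
    ring
  exact h.comp_measurable (by fun_prop)

lemma integral_comp_add_pi_gaussianReal (hv : v ≠ 0) (g : (ι → ℝ) → ℝ) (x : ι → ℝ) :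
    ∫ δ, g (x + δ) ∂(Measure.pi fun _ : ι => gaussianReal 0 v)
      = Real.exp (-((v : ℝ)⁻¹ * (∑ i, x i ^ 2) / 2)) *
        ∫ y, Real.exp (scaledDot ι v y x) * g y ∂(Measure.pi fun _ : ι => gaussianReal 0 v) := by
  rw [← (measurableEmbedding_addLeft x).integral_map (g := g), map_const_add_pi_gaussianReal hv,
    integral_withDensity_eq_integral_toReal_smul (by fun_prop)
      (.of_forall fun _ => ENNReal.ofReal_lt_top), ← integral_const_mul]
  refine integral_congr_ae (.of_forall fun y => ?_)
  dsimp only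
  rw [ENNReal.toReal_ofReal (Real.exp_pos _).le]
  simp only [smul_eq_mul, scaledDot_apply, sub_eq_add_neg, Real.exp_add]
  ring

/-- The derivative of a Gaussian smoothing, in terms of Gaussian smoothings. -/
lemma hasFDerivAt_integral_comp_add_pi_gaussianReal (hv : v ≠ 0)
    (hg : ExpIntegrable (Measure.pi fun _ : ι => gaussianReal 0 v) g) (x : ι → ℝ) :
    ∃ D : (ι → ℝ) →L[ℝ] ℝ,
      HasFDerivAt (fun z => ∫ δ, g (z + δ) ∂(Measure.pi fun _ : ι => gaussianReal 0 v)) D x ∧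
      ∀ e, D e = ∫ δ, scaledDot ι v (x + δ) e * g (x + δ)
            ∂(Measure.pi fun _ : ι => gaussianReal 0 v)
          - scaledDot ι v x e * ∫ δ, g (x + δ) ∂(Measure.pi fun _ : ι => gaussianReal 0 v) := by
  obtain ⟨hi, hder⟩ := hg.hasFDerivAt_laplace (scaledDot ι v) x
  have hQ : HasFDerivAt (fun z : ι → ℝ => Real.exp (-((v : ℝ)⁻¹ * (∑ i, z i ^ 2) / 2)))
      (Real.exp (-((v : ℝ)⁻¹ * (∑ i, x i ^ 2) / 2)) • -scaledDot ι v x) x := by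
    refine HasFDerivAt.exp ?_
    have h1 (i : ι) : HasFDerivAt (fun z : ι → ℝ => z i ^ 2)
        ((2 * x i) • ContinuousLinearMap.proj (R := ℝ) (φ := fun _ : ι => ℝ) i) x := by
      simpa using (hasFDerivAt_apply (𝕜 := ℝ) i x).pow 2
    have h2 := (((HasFDerivAt.fun_sum fun i (_ : i ∈ Finset.univ) => h1 i).const_mul
      (v : ℝ)⁻¹).mul_const (2⁻¹ : ℝ)).neg
    simp only [← div_eq_mul_inv] at h2
    refine h2.congr_fderiv ?_
    ext e
    simp only [_root_.neg_apply, _root_.smul_apply, scaledDot_apply,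
      _root_.sum_apply, ContinuousLinearMap.proj_apply, smul_eq_mul, mul_assoc,
      ← Finset.mul_sum]
    ring
  refine ⟨_, (hQ.mul hder).congr_of_eventuallyEq
    (.of_forall fun z => integral_comp_add_pi_gaussianReal hv g z), fun e => ?_⟩
  rw [integral_comp_add_pi_gaussianReal hv (fun y => scaledDot ι v y e * g y),
    integral_comp_add_pi_gaussianReal hv g]
  simp only [_root_.add_apply, _root_.smul_apply,
    _root_.neg_apply, smul_eq_mul, ContinuousLinearMap.integral_apply hi]
  simp only [mul_assoc, mul_comm (g _)]
  ring

end GaussianSmoothing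

/-- Randomized-smoothing (Stein) Hessian identity: for `γ = N(0, σ²I_d)` and bounded
measurable `f`, the Gaussian smoothing `u(x) = ∫ f(x+δ) dγ(δ)` is twice differentiable at
every `x`, with second-order partial derivatives
`∂²u/∂x_i∂x_j(x) = (1/σ⁴) ∫ (δ_i δ_j − σ² δ_{ij}) f(x+δ) dγ(δ)`. -/
theorem randomized_smoothing_hessian {d : ℕ} (hd : 1 ≤ d) (σ : ℝ) (hσ : 0 < σ)
    (f : (Fin d → ℝ) → ℝ) (hfm : Measurable f) (M : ℝ) (hfb : ∀ y, |f y| ≤ M) :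
    let γ : Measure (Fin d → ℝ) :=
      Measure.pi fun _ : Fin d => gaussianReal 0 ⟨σ ^ 2, sq_nonneg σ⟩
    let u : (Fin d → ℝ) → ℝ := fun x => ∫ δ, f (x + δ) ∂γ
    ∀ x : Fin d → ℝ,
      DifferentiableAt ℝ u x ∧
      DifferentiableAt ℝ (fderiv ℝ u) x ∧
      ∀ i j : Fin d,
        fderiv ℝ (fun y => fderiv ℝ u y (Pi.single j 1)) x (Pi.single i 1)
          = (1 / σ ^ 4) *
              ∫ δ, (δ i * δ j - σ ^ 2 * (if i = j then (1 : ℝ) else 0)) * f (x + δ) ∂γ := by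
  intro γ u x
  set v : ℝ≥0 := ⟨σ ^ 2, sq_nonneg σ⟩
  have hvσ : (v : ℝ) = σ ^ 2 := rfl
  have hv : v ≠ 0 := by
    rw [← NNReal.coe_ne_zero, hvσ]; positivity
  have hf : ExpIntegrable γ f := expIntegrable_pi_gaussianReal_of_bounded hfm hfb
  have hcoord (y : Fin d → ℝ) (i : Fin d) :
      scaledDot (Fin d) v y (Pi.single i 1) = (σ ^ 2)⁻¹ * y i := by
    simp [scaledDot_apply, hvσ, Pi.single_apply]
  have hmul {g : (Fin d → ℝ) → ℝ} (hg : ExpIntegrable γ g) (i : Fin d) :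
      ExpIntegrable γ fun y => (σ ^ 2)⁻¹ * y i * g y := by
    have := hg.clm_mul ((scaledDot (Fin d) v).flip (Pi.single i 1))
    simpa only [ContinuousLinearMap.flip_apply, hcoord] using this
  have hD {g : (Fin d → ℝ) → ℝ} (hg : ExpIntegrable γ g) (z : Fin d → ℝ) :
      DifferentiableAt ℝ (fun z => ∫ δ, g (z + δ) ∂γ) z ∧
      ∀ i, fderiv ℝ (fun z => ∫ δ, g (z + δ) ∂γ) z (Pi.single i 1)
        = ∫ δ, (σ ^ 2)⁻¹ * (z + δ) i * g (z + δ) ∂γ - (σ ^ 2)⁻¹ * z i * ∫ δ, g (z + δ) ∂γ := by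
    obtain ⟨D, hD, hDe⟩ := hasFDerivAt_integral_comp_add_pi_gaussianReal hv hg z
    refine ⟨hD.differentiableAt, fun i => ?_⟩
    rw [hD.fderiv, hDe]
    simp only [hcoord]
    rfl
  have hpart (j : Fin d) : (fun y => fderiv ℝ u y (Pi.single j 1)) = fun z =>
      ∫ δ, (σ ^ 2)⁻¹ * (z + δ) j * f (z + δ) ∂γ - (σ ^ 2)⁻¹ * z j * u z :=
    funext fun z => (hD hf z).2 j
  have hu : DifferentiableAt ℝ u x := (hD hf x).1
  have hlin (j : Fin d) : HasFDerivAt (fun z : Fin d → ℝ => (σ ^ 2)⁻¹ * z j)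
      ((σ ^ 2)⁻¹ • ContinuousLinearMap.proj (R := ℝ) (φ := fun _ : Fin d => ℝ) j) x :=
    (hasFDerivAt_apply (𝕜 := ℝ) j x).const_mul _
  have hpart' (j : Fin d) := ((hD (hmul hf j) x).1.hasFDerivAt).fun_sub
    ((hlin j).fun_mul hu.hasFDerivAt)
  refine ⟨hu, ?_, fun i j => ?_⟩
  · have hsum : fderiv ℝ u = fun z => ∑ j, (fderiv ℝ u z (Pi.single j 1)) •
        ContinuousLinearMap.proj (R := ℝ) (φ := fun _ : Fin d => ℝ) j := by
      funext z
      refine ContinuousLinearMap.ext fun e => ?_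
      conv_lhs => rw [pi_eq_sum_univ' e]
      simp [mul_comm]
    rw [hsum]
    refine DifferentiableAt.fun_sum fun j _ => DifferentiableAt.smul_const ?_ _
    rw [hpart]
    exact (hpart' j).differentiableAt
  · rw [hpart, (hpart' j).fderiv]
    have hui : fderiv ℝ u x (Pi.single i 1) = _ := (hD hf x).2 i
    simp only [_root_.sub_apply, _root_.add_apply,
      _root_.smul_apply, ContinuousLinearMap.proj_apply, smul_eq_mul,
      (hD (hmul hf j) x).2 i, hui]
    have hI {g : (Fin d → ℝ) → ℝ} (hg : ExpIntegrable γ g) :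
        Integrable (fun δ => g (x + δ)) γ := integrable_comp_add_pi_gaussianReal hv hg x
    have h0 := hI hf
    have h1 := hI (hmul hf i)
    have h2 := hI (hmul hf j)
    have h3 := hI (hmul (hmul hf j) i)
    have hsplit (δ : Fin d → ℝ) :
        (δ i * δ j - σ ^ 2 * (if i = j then (1 : ℝ) else 0)) * f (x + δ)
          = σ ^ 4 * ((σ ^ 2)⁻¹ * (x + δ) i * ((σ ^ 2)⁻¹ * (x + δ) j * f (x + δ)))
            - σ ^ 2 * x i * ((σ ^ 2)⁻¹ * (x + δ) j * f (x + δ))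
            - σ ^ 2 * x j * ((σ ^ 2)⁻¹ * (x + δ) i * f (x + δ))
            + (x i * x j - σ ^ 2 * (if i = j then (1 : ℝ) else 0)) * f (x + δ) := by
      simp only [Pi.add_apply]
      field_simp
      ring
    have h32 := (h3.const_mul (σ ^ 4)).sub (h2.const_mul (σ ^ 2 * x i))
    have h321 := h32.sub (h1.const_mul (σ ^ 2 * x j))
    simp only [Pi.sub_def] at h32 h321
    simp only [hsplit]
    rw [integral_add h321 (h0.const_mul _), integral_sub h32 (h1.const_mul _),
      integral_sub (h3.const_mul _) (h2.const_mul _)]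
    simp only [integral_const_mul, Pi.single_apply, eq_comm (a := j)]
    change _ = 1 / σ ^ 4 * (_ + _ * u x)
    field_simp
    ring
end

section
/- Let d ≥ 1, T > 0, μ ∈ ℝ^d, σ a d×d real matrix, and let ξ be a random vector in ℝ^d satisfying E[ξ_i] = 0, E[ξ_i ξ_j] = δ_{ij}, E[ξ_i ξ_j ξ_k] = 0 for all i, j, k, and E[‖ξ‖⁴] < ∞. Let f : [0,T] × ℝ^d × ℝ → ℝ, and suppose u : [0, T] × ℝ^d → ℝ is of class C^{2,4} with all the relevant partial derivatives bounded and is a classical solution of the parabolic equation ∂_t u(t,x) + μᵀ∇u(t,x) + ½ Tr(σσᵀ ∇∇ᵀ u(t,x)) = f(t, x, u(t,x)) on [0, T] × ℝ^d. Define the random-difference residual R(t, x, ξ; u) := D_h(t, x, ξ; u) − f(t, x, u(t, x)) where D_h(t, x, ξ; u) := (u(t + h, x + μh + √h σξ) − u(t, x))/h. Then there exists C ≥ 0 such that |E[R(t, x, ξ; u)]| ≤ C h for all h > 0 and all (t, x) ∈ [0, T − h] × ℝ^d; that is, the exact solution satisfies the random-difference residual condition up to O(h). -/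
open MeasureTheory ProbabilityTheory

section Taylor

variable {E G : Type*} [NormedAddCommGroup E] [NormedSpace ℝ E]
  [NormedAddCommGroup G] [NormedSpace ℝ G]

lemma iteratedDeriv_comp_line {F : E → G} {n : ℕ} (hF : ContDiff ℝ n F) (p v : E) (τ : ℝ) :
    iteratedDeriv n (fun τ : ℝ => F (p + τ • v)) τ
      = iteratedFDeriv ℝ n F (p + τ • v) fun _ => v := by
  have hcomp : (fun τ : ℝ => F (p + τ • v))
      = (fun q => F (p + q)) ∘ (ContinuousLinearMap.toSpanSingleton ℝ v) := by
    ext τ; simp [ContinuousLinearMap.toSpanSingleton_apply]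
  rw [iteratedDeriv_eq_iteratedFDeriv, hcomp,
    ContinuousLinearMap.iteratedFDeriv_comp_right (i := n) _
      (f := fun q => F (p + q)) (hF.comp (contDiff_const.add contDiff_id)) _ le_rfl,
    iteratedFDeriv_comp_add_left]
  simp [ContinuousLinearMap.toSpanSingleton_apply]

/-- Taylor's theorem on a normed space, with a crude constant in the remainder. -/
lemma norm_sub_taylor_le {F : E → G} {n : ℕ} (hF : ContDiff ℝ (n + 1 : ℕ) F) {M : ℝ}
    (hM : ∀ q, ‖iteratedFDeriv ℝ (n + 1) F q‖ ≤ M) (p v : E) :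
    ‖F (p + v) - ∑ k ∈ Finset.range (n + 1),
        ((k.factorial : ℝ)⁻¹) • iteratedFDeriv ℝ k F p fun _ => v‖
      ≤ M * ‖v‖ ^ (n + 1) := by
  have hM0 : 0 ≤ M := (norm_nonneg _).trans (hM p)
  have hg : ContDiff ℝ (n + 1 : ℕ) fun τ : ℝ => F (p + τ • v) :=
    hF.comp (contDiff_const.add (contDiff_id.smul contDiff_const))
  have hwithin : ∀ k ≤ n + 1, ∀ τ ∈ Set.Icc (0 : ℝ) 1,
      iteratedDerivWithin k (fun τ : ℝ => F (p + τ • v)) (Set.Icc 0 1) τ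
        = iteratedFDeriv ℝ k F (p + τ • v) fun _ => v := fun k hk τ hτ => by
    have hk' : (k : WithTop ℕ∞) ≤ (n + 1 : ℕ) := by exact_mod_cast hk
    rw [iteratedDerivWithin_eq_iteratedDeriv (uniqueDiffOn_Icc one_pos)
      (hg.of_le hk').contDiffAt hτ, iteratedDeriv_comp_line (hF.of_le hk')]
  have h := taylor_mean_remainder_bound (n := n) (C := M * ‖v‖ ^ (n + 1)) zero_le_one
    (by exact_mod_cast hg.contDiffOn) (Set.right_mem_Icc.2 zero_le_one) fun τ hτ => by
      rw [hwithin _ le_rfl τ hτ]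
      refine (ContinuousMultilinearMap.le_opNorm _ _).trans ?_
      simpa using mul_le_mul_of_nonneg_right (hM (p + τ • v)) (by positivity)
  have hpoly : taylorWithinEval (fun τ : ℝ => F (p + τ • v)) n (Set.Icc 0 1) 0 1
      = ∑ k ∈ Finset.range (n + 1),
        ((k.factorial : ℝ)⁻¹) • iteratedFDeriv ℝ k F p fun _ => v := by
    rw [taylor_within_apply]
    refine Finset.sum_congr rfl fun k hk => ?_
    rw [hwithin k (Finset.mem_range.1 hk).le 0 (Set.left_mem_Icc.2 zero_le_one)]
    simp
  rw [hpoly, one_smul] at h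
  refine h.trans ?_
  rw [sub_zero, one_pow, mul_one]
  exact div_le_self (by positivity) (by exact_mod_cast n.factorial_pos)

/-- Taylor expansion along `s • w + s ^ 2 • a`, to fourth order in `w` and first order in `a`. -/
lemma abs_sub_split_taylor_le {F : E → ℝ} (hF : ContDiff ℝ 4 F) {M₂ M₃ M₄ : ℝ}
    (hM₂ : ∀ q, ‖iteratedFDeriv ℝ 2 F q‖ ≤ M₂) (hM₃ : ∀ q, ‖iteratedFDeriv ℝ 3 F q‖ ≤ M₃)
    (hM₄ : ∀ q, ‖iteratedFDeriv ℝ 4 F q‖ ≤ M₄) {s : ℝ} (p a w : E) :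
    |F (p + s • w + (s ^ 2) • a) - (F p + s ^ 2 * fderiv ℝ F p a
        + s * iteratedFDeriv ℝ 1 F p (fun _ => w)
        + s ^ 2 / 2 * iteratedFDeriv ℝ 2 F p (fun _ => w)
        + s ^ 3 / 6 * iteratedFDeriv ℝ 3 F p (fun _ => w)
        + s ^ 3 * iteratedFDeriv ℝ 1 (fun q => fderiv ℝ F q a) p (fun _ => w))|
      ≤ (s ^ 2) ^ 2 * (M₂ * ‖a‖ ^ 2 + ‖a‖ * M₃ * ‖w‖ ^ 2 + M₄ * ‖w‖ ^ 4) := by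
  have hDF : ContDiff ℝ 2 (fderiv ℝ F) := (hF.of_le (by norm_num)).fderiv_right (m := 2) le_rfl
  have hG : ContDiff ℝ 2 fun q => fderiv ℝ F q a := hDF.clm_apply contDiff_const
  have hGM : ∀ q, ‖iteratedFDeriv ℝ (1 + 1) (fun q => fderiv ℝ F q a) q‖ ≤ ‖a‖ * M₃ := fun q =>
    (norm_iteratedFDeriv_clm_apply_const (n := 2) hDF.contDiffAt le_rfl).trans
      (mul_le_mul_of_nonneg_left (norm_iteratedFDeriv_fderiv.trans_le (hM₃ q)) (norm_nonneg _))
  have hscale : ∀ (k : ℕ) (L : ContinuousMultilinearMap ℝ (fun _ : Fin k => E) ℝ) (c : ℝ) (v : E),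
      L (fun _ => c • v) = c ^ k * L fun _ => v := fun k L c v => by
    simpa using L.map_smul_univ (fun _ => c) fun _ => v
  have hdrift := norm_sub_taylor_le (n := 1) (hF.of_le (by norm_num)) hM₂ (p + s • w) (s ^ 2 • a)
  have hmixed := norm_sub_taylor_le (n := 1) hG hGM p (s • w)
  have hnoise := norm_sub_taylor_le (n := 3) hF hM₄ p (s • w)
  simp only [Finset.sum_range_succ, Finset.sum_range_zero, hscale, norm_smul, Real.norm_eq_abs,
    iteratedFDeriv_zero_apply, smul_eq_mul, mul_pow, abs_pow, sq_abs, Nat.factorial] at *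
  norm_num at hdrift hmixed hnoise ⊢
  have hs4 : |s| ^ 4 = (s ^ 2) ^ 2 := by rw [← sq_abs s]; ring
  rw [hs4] at hnoise
  have hmixed' := mul_le_mul_of_nonneg_left hmixed (sq_nonneg s)
  rw [← abs_of_nonneg (sq_nonneg s), ← abs_mul, abs_of_nonneg (sq_nonneg s)] at hmixed'
  rw [abs_le] at *
  constructor <;> linarith [hdrift.1, hdrift.2, hmixed'.1, hmixed'.2, hnoise.1, hnoise.2]

end Taylor

section Moments

variable {E ι : Type*} [NormedAddCommGroup E] [NormedSpace ℝ E] [Fintype ι]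

lemma ContinuousMultilinearMap.apply_sum_smul {k : ℕ}
    (L : ContinuousMultilinearMap ℝ (fun _ : Fin k => E) ℝ) (c : ι → ℝ) (b : ι → E) :
    L (fun _ => ∑ i, c i • b i) = ∑ r : Fin k → ι, (∏ j, c (r j)) * L fun j => b (r j) := by
  classical
  rw [L.map_sum]
  exact Finset.sum_congr rfl fun r _ => L.map_smul_univ (fun j => c (r j)) fun j => b (r j)

lemma norm_sum_smul_le (c : ι → ℝ) (b : ι → E) :
    ‖∑ i, c i • b i‖ ≤ (∑ i, ‖b i‖) * ∑ i, |c i| := by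
  refine (norm_sum_le _ _).trans ?_
  rw [Finset.mul_sum]
  refine Finset.sum_le_sum fun i _ => ?_
  rw [norm_smul, Real.norm_eq_abs, mul_comm]
  exact mul_le_mul_of_nonneg_right
    (Finset.single_le_sum (fun j _ => norm_nonneg (b j)) (Finset.mem_univ i)) (abs_nonneg _)

variable {Ω : Type*} [MeasurableSpace Ω] {P : Measure Ω} [IsFiniteMeasure P] {ξ : Ω → ι → ℝ}

lemma integrable_sum_abs_pow (hξ : Measurable ξ) {n : ℕ}
    (hmom : Integrable (fun ω => (∑ i, |ξ ω i|) ^ n) P) {k : ℕ} (hk : k ≤ n) :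
    Integrable (fun ω => (∑ i, |ξ ω i|) ^ k) P := by
  refine (hmom.add (integrable_const (1 : ℝ))).mono' (by fun_prop) (.of_forall fun ω => ?_)
  have h0 : 0 ≤ ∑ i, |ξ ω i| := Finset.sum_nonneg fun i _ => abs_nonneg _
  rw [Real.norm_of_nonneg (by positivity)]
  simp only [Pi.add_apply]
  rcases le_total (∑ i, |ξ ω i|) 1 with h | h
  · linarith [pow_le_one₀ (n := k) h0 h, pow_nonneg h0 n]
  · linarith [pow_le_pow_right₀ h hk]

lemma integrable_prod_coord (hξ : Measurable ξ) {n : ℕ}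
    (hmom : Integrable (fun ω => (∑ i, |ξ ω i|) ^ n) P) {k : ℕ} (hk : k ≤ n) (r : Fin k → ι) :
    Integrable (fun ω => ∏ j, ξ ω (r j)) P := by
  refine (integrable_sum_abs_pow hξ hmom hk).mono'
    (Measurable.aestronglyMeasurable (by fun_prop)) (.of_forall fun ω => ?_)
  rw [norm_prod]
  refine (Finset.prod_le_prod (fun _ _ => norm_nonneg _) fun j _ =>
    Finset.single_le_sum (f := fun i => |ξ ω i|) (fun i _ => abs_nonneg _)
      (Finset.mem_univ (r j))).trans_eq ?_
  simp

lemma integrable_and_integral_multilinear_sum_smul (hξ : Measurable ξ) {n : ℕ}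
    (hmom : Integrable (fun ω => (∑ i, |ξ ω i|) ^ n) P) {k : ℕ} (hk : k ≤ n)
    (L : ContinuousMultilinearMap ℝ (fun _ : Fin k => E) ℝ) (b : ι → E) :
    Integrable (fun ω => L fun _ => ∑ i, ξ ω i • b i) P ∧
      ∫ ω, L (fun _ => ∑ i, ξ ω i • b i) ∂P
        = ∑ r : Fin k → ι, (∫ ω, ∏ j, ξ ω (r j) ∂P) * L fun j => b (r j) := by
  have hr := fun r : Fin k → ι =>
    (integrable_prod_coord hξ hmom hk r).mul_const (L fun j => b (r j))
  simp only [L.apply_sum_smul]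
  refine ⟨integrable_finsetSum _ fun r _ => hr r, ?_⟩
  rw [integral_finsetSum _ fun r _ => hr r]
  simp only [integral_mul_const]

end Moments

section PartialDerivatives

variable {E : Type*} [NormedAddCommGroup E] [NormedSpace ℝ E] {u : ℝ → E → ℝ}

lemma deriv_fst_eq_fderiv (hu : Differentiable ℝ fun p : ℝ × E => u p.1 p.2) (t : ℝ) (x : E) :
    deriv (fun s => u s x) t = fderiv ℝ (fun p : ℝ × E => u p.1 p.2) (t, x) (1, 0) := by
  have h := HasFDerivAt.comp_hasDerivAt t (f := fun s => (s, x)) (hu (t, x)).hasFDerivAt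
    ((hasDerivAt_id t).prodMk (hasDerivAt_const t x))
  exact h.deriv

lemma fderiv_snd_eq_fderiv (hu : Differentiable ℝ fun p : ℝ × E => u p.1 p.2) (t : ℝ) (x v : E) :
    fderiv ℝ (fun y => u t y) x v = fderiv ℝ (fun p : ℝ × E => u p.1 p.2) (t, x) (0, v) := by
  have h := ((hu (t, x)).hasFDerivAt.comp x (hasFDerivAt_prodMk_right t x)).fderiv
  exact DFunLike.congr_fun h v

lemma iteratedFDeriv_snd_eq {n : ℕ} (hu : ContDiff ℝ n fun p : ℝ × E => u p.1 p.2) (t : ℝ) (x : E)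
    (v : Fin n → E) :
    iteratedFDeriv ℝ n (fun y => u t y) x v
      = iteratedFDeriv ℝ n (fun p : ℝ × E => u p.1 p.2) (t, x) fun j => (0, v j) := by
  have hcomp : (fun y => u t y) = (fun q : ℝ × E => u ((t, 0) + q).1 ((t, 0) + q).2)
      ∘ ContinuousLinearMap.inr ℝ ℝ E := by
    ext y; simp
  have hshift : ContDiff ℝ n fun q : ℝ × E => u ((t, 0) + q).1 ((t, 0) + q).2 :=
    hu.comp (contDiff_const.add contDiff_id)
  rw [hcomp, ContinuousLinearMap.iteratedFDeriv_comp_right _ hshift _ le_rfl,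
    iteratedFDeriv_comp_add_left (f := fun p : ℝ × E => u p.1 p.2)]
  simp

end PartialDerivatives

section Residual

variable {E ι : Type*} [NormedAddCommGroup E] [NormedSpace ℝ E] [Fintype ι]

lemma sum_multilinear_two_col (L : ContinuousMultilinearMap ℝ (fun _ : Fin 2 => E) ℝ)
    (σ : Matrix ι ι ℝ) (e : ι → E) :
    ∑ k, L (fun _ => ∑ i, σ i k • e i)
      = ∑ i, ∑ j, (σ * σ.transpose) i j * L ![e i, e j] := by
  have hvec : ∀ i j : ι, (fun l => e (![i, j] l)) = ![e i, e j] := fun i j => by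
    ext l; fin_cases l <;> rfl
  simp only [L.apply_sum_smul]
  rw [Finset.sum_comm, ← (finTwoArrowEquiv ι).symm.sum_comp, Fintype.sum_prod_type]
  refine Finset.sum_congr rfl fun i _ => Finset.sum_congr rfl fun j _ => ?_
  simp [finTwoArrowEquiv, hvec, Matrix.mul_apply, Finset.sum_mul]

variable {Ω : Type*} [MeasurableSpace Ω] {P : Measure Ω} [IsProbabilityMeasure P]
  {ξ : Ω → ι → ℝ}

/-- Weak consistency of order one of the random difference quotient with noise directions `b` and
drift `a`, uniformly in the base point. -/
lemma exists_abs_integral_residual_le [DecidableEq ι] (hξ : Measurable ξ)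
    (hmean : ∀ i, ∫ ω, ξ ω i ∂P = 0)
    (hcov : ∀ i j, ∫ ω, ξ ω i * ξ ω j ∂P = if i = j then 1 else 0)
    (hthird : ∀ i j k, ∫ ω, ξ ω i * ξ ω j * ξ ω k ∂P = 0)
    (hfourth : Integrable (fun ω => (∑ i, |ξ ω i|) ^ 4) P)
    {F : E → ℝ} (hF : ContDiff ℝ 4 F)
    (hbd : ∀ k : ℕ, k ≤ 4 → ∃ M, ∀ q, ‖iteratedFDeriv ℝ k F q‖ ≤ M) (a : E) (b : ι → E) :
    ∃ C : ℝ, 0 ≤ C ∧ ∀ h : ℝ, 0 < h → ∀ p : E,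
      |∫ ω, ((F (p + √h • (∑ i, ξ ω i • b i) + h • a) - F p) / h
          - (fderiv ℝ F p a + 1 / 2 * ∑ i, iteratedFDeriv ℝ 2 F p fun _ => b i)) ∂P|
        ≤ C * h := by
  obtain ⟨M₀, hM₀⟩ := hbd 0 (by norm_num)
  obtain ⟨M₂, hM₂⟩ := hbd 2 (by norm_num)
  obtain ⟨M₃, hM₃⟩ := hbd 3 (by norm_num)
  obtain ⟨M₄, hM₄⟩ := hbd 4 le_rfl
  have hM₂0 := (norm_nonneg _).trans (hM₂ 0)
  have hM₃0 := (norm_nonneg _).trans (hM₃ 0)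
  have hM₄0 := (norm_nonneg _).trans (hM₄ 0)
  set K := ∑ i, ‖b i‖
  have hK0 : 0 ≤ K := Finset.sum_nonneg fun i _ => norm_nonneg _
  let S : Ω → ℝ := fun ω => ∑ i, |ξ ω i|
  have hS0 : ∀ ω, 0 ≤ S ω := fun ω => Finset.sum_nonneg fun i _ => abs_nonneg _
  let w : Ω → E := fun ω => ∑ i, ξ ω i • b i
  let Z : Ω → ℝ := fun ω =>
    M₂ * ‖a‖ ^ 2 + ‖a‖ * M₃ * K ^ 2 * S ω ^ 2 + M₄ * K ^ 4 * S ω ^ 4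
  have hZ : Integrable Z P :=
    ((integrable_const _).add
      ((integrable_sum_abs_pow hξ hfourth (k := 2) (by norm_num)).const_mul _)).add
      (hfourth.const_mul _)
  refine ⟨∫ ω, Z ω ∂P, integral_nonneg fun ω => ?_, fun h hh p => ?_⟩
  · have := hS0 ω
    simp only [Z, Pi.zero_apply]
    positivity
  set s := √h
  have hsh : s ^ 2 = h := Real.sq_sqrt hh.le
  have hone := fun L : ContinuousMultilinearMap ℝ (fun _ : Fin 1 => E) ℝ =>
    integrable_and_integral_multilinear_sum_smul hξ hfourth (k := 1) (by norm_num) L b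
  have htwo := integrable_and_integral_multilinear_sum_smul hξ hfourth (k := 2) (by norm_num)
    (iteratedFDeriv ℝ 2 F p) b
  have hthree := integrable_and_integral_multilinear_sum_smul hξ hfourth (k := 3) (by norm_num)
    (iteratedFDeriv ℝ 3 F p) b
  simp only [Fin.prod_univ_succ, Fin.prod_univ_zero, mul_one, ← mul_assoc, hmean, hcov, hthird,
    zero_mul, Finset.sum_const_zero] at hone htwo hthree
  have hcov_sum : ∀ L : ContinuousMultilinearMap ℝ (fun _ : Fin 2 => E) ℝ,
      ∑ r : Fin 2 → ι, (if r 0 = r (Fin.succ 0) then (1 : ℝ) else 0) * L (fun j => b (r j))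
        = ∑ i, L fun _ => b i := fun L => by
    have hvec : ∀ i : ι, (fun l => b (![i, i] l)) = fun _ : Fin 2 => b i := fun i => by
      ext l; fin_cases l <;> rfl
    rw [← (finTwoArrowEquiv ι).symm.sum_comp, Fintype.sum_prod_type]
    simp [finTwoArrowEquiv, hvec]
  rw [hcov_sum] at htwo
  let φ : Ω → ℝ := fun ω => F (p + s • w ω + h • a)
  have hφ : Integrable φ P := by
    refine (integrable_const M₀).mono' ?_ (.of_forall fun ω => ?_)
    · have hcont : Continuous fun y : ι → ℝ => F (p + s • (∑ i, y i • b i) + h • a) :=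
        hF.continuous.comp (by fun_prop)
      exact (hcont.measurable.comp hξ).aestronglyMeasurable
    · simpa using hM₀ (p + s • w ω + h • a)
  let ψ : Ω → ℝ := fun ω => s * iteratedFDeriv ℝ 1 F p (fun _ => w ω)
    + s ^ 2 / 2 * iteratedFDeriv ℝ 2 F p (fun _ => w ω)
    + s ^ 3 / 6 * iteratedFDeriv ℝ 3 F p (fun _ => w ω)
    + s ^ 3 * iteratedFDeriv ℝ 1 (fun q => fderiv ℝ F q a) p (fun _ => w ω)
  have i1 := (hone (iteratedFDeriv ℝ 1 F p)).1.const_mul s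
  have i2 := htwo.1.const_mul (s ^ 2 / 2)
  have i3 := hthree.1.const_mul (s ^ 3 / 6)
  have i4 := (hone (iteratedFDeriv ℝ 1 (fun q => fderiv ℝ F q a) p)).1.const_mul (s ^ 3)
  have hψ : Integrable ψ P := ((i1.add i2).add i3).add i4
  have hψ_int : ∫ ω, ψ ω ∂P = h / 2 * ∑ i, iteratedFDeriv ℝ 2 F p fun _ => b i := by
    simp only [ψ, w]
    rw [integral_add ((i1.fun_add i2).fun_add i3) i4, integral_add (i1.fun_add i2) i3,
      integral_add i1 i2]
    simp only [integral_const_mul, (hone _).2, htwo.2, hthree.2, hsh]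
    ring
  have hrem : ∀ ω, |φ ω - (F p + h * fderiv ℝ F p a + ψ ω)| ≤ h ^ 2 * Z ω := fun ω => by
    have hw : ‖w ω‖ ≤ K * S ω := norm_sum_smul_le _ _
    have hT := abs_sub_split_taylor_le hF hM₂ hM₃ hM₄ (s := s) p a (w ω)
    rw [hsh] at hT
    have hZω : M₂ * ‖a‖ ^ 2 + ‖a‖ * M₃ * ‖w ω‖ ^ 2 + M₄ * ‖w ω‖ ^ 4 ≤ Z ω := by
      calc _ ≤ M₂ * ‖a‖ ^ 2 + ‖a‖ * M₃ * (K * S ω) ^ 2 + M₄ * (K * S ω) ^ 4 := by gcongr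
        _ = Z ω := by simp only [Z]; ring
    refine le_trans (le_of_eq ?_) (hT.trans (mul_le_mul_of_nonneg_left hZω (sq_nonneg h)))
    simp only [φ, ψ, hsh]
    congr 1
    ring
  have hrem_int : |∫ ω, (φ ω - (F p + h * fderiv ℝ F p a + ψ ω)) ∂P| ≤ h ^ 2 * ∫ ω, Z ω ∂P := by
    rw [← integral_const_mul]
    exact (abs_integral_le_integral_abs).trans
      (integral_mono ((hφ.sub ((integrable_const _).add hψ)).abs) (hZ.const_mul _) hrem)
  rw [integral_sub hφ ((integrable_const _).fun_add hψ), integral_add (integrable_const _) hψ,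
    hψ_int] at hrem_int
  simp only [integral_const, probReal_univ, one_smul] at hrem_int
  have hres : ∫ ω, ((F (p + s • (∑ i, ξ ω i • b i) + h • a) - F p) / h
        - (fderiv ℝ F p a + 1 / 2 * ∑ i, iteratedFDeriv ℝ 2 F p fun _ => b i)) ∂P
      = (∫ ω, φ ω ∂P - (F p + h * fderiv ℝ F p a
          + h / 2 * ∑ i, iteratedFDeriv ℝ 2 F p fun _ => b i)) / h := by
    change ∫ ω, ((φ ω - F p) / h - _) ∂P = _
    have hdiff : Integrable (fun ω => φ ω - F p) P := hφ.sub (integrable_const _)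
    rw [integral_sub (hdiff.div_const h) (integrable_const _),
      integral_div, integral_sub hφ (integrable_const _)]
    simp only [integral_const, probReal_univ, one_smul]
    field_simp
    ring
  rw [hres, abs_div, abs_of_pos hh, div_le_iff₀ hh]
  linarith [hrem_int]

end Residual

/-- The exact solution of the parabolic PDE
`∂_t u + μᵀ∇u + ½ Tr(σσᵀ ∇∇ᵀu) = f(t, x, u)` satisfies the random-difference residual
condition up to `O(h)`: with `D_h(t,x,ξ;u) = (u(t+h, x+μh+√hσξ) − u(t,x))/h` and
`R = D_h − f(t,x,u(t,x))`, there is `C ≥ 0` with `|E[R(t,x,ξ;u)]| ≤ C h` for all `h > 0`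
and `(t,x) ∈ [0, T−h] × ℝ^d`. -/
theorem random_difference_residual_of_solution {d : ℕ} (hd : 1 ≤ d) (T : ℝ) (hT : 0 < T)
    (μ : Fin d → ℝ) (σ : Matrix (Fin d) (Fin d) ℝ)
    {Ω : Type*} [MeasureSpace Ω] [IsProbabilityMeasure (ℙ : Measure Ω)]
    (ξ : Ω → Fin d → ℝ) (hξm : Measurable ξ)
    (hmean : ∀ i, (∫ ω, ξ ω i) = 0)
    (hcov : ∀ i j, (∫ ω, ξ ω i * ξ ω j) = if i = j then (1 : ℝ) else 0)
    (hthird : ∀ i j k, (∫ ω, ξ ω i * ξ ω j * ξ ω k) = 0)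
    (hfourth : Integrable fun ω => (∑ i, |ξ ω i|) ^ 4)
    (f : ℝ → (Fin d → ℝ) → ℝ → ℝ)
    (u : ℝ → (Fin d → ℝ) → ℝ)
    (hu : ContDiff ℝ 4 fun p : ℝ × (Fin d → ℝ) => u p.1 p.2)
    (hubd : ∀ k : ℕ, k ≤ 4 → ∃ M, ∀ p : ℝ × (Fin d → ℝ),
      ‖iteratedFDeriv ℝ k (fun q : ℝ × (Fin d → ℝ) => u q.1 q.2) p‖ ≤ M)
    (hpde : ∀ (t : ℝ) (x : Fin d → ℝ), 0 ≤ t → t ≤ T →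
      deriv (fun s => u s x) t
        + (∑ i, μ i * fderiv ℝ (fun y => u t y) x (Pi.single i 1))
        + (1 / 2) * ∑ i, ∑ j, (σ * σ.transpose) i j *
            iteratedFDeriv ℝ 2 (fun y => u t y) x ![Pi.single i 1, Pi.single j 1]
      = f t x (u t x)) :
    ∃ C : ℝ, 0 ≤ C ∧ ∀ h : ℝ, 0 < h → ∀ (t : ℝ) (x : Fin d → ℝ),
      0 ≤ t → t ≤ T - h →
      |(∫ ω, ((u (t + h)
              (fun i => x i + μ i * h + Real.sqrt h * σ.mulVec (ξ ω) i) - u t x) / h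
            - f t x (u t x)))|
        ≤ C * h := by
  let F : ℝ × (Fin d → ℝ) → ℝ := fun p => u p.1 p.2
  let e : Fin d → ℝ × (Fin d → ℝ) := fun i => (0, Pi.single i 1)
  let b : Fin d → ℝ × (Fin d → ℝ) := fun k => ∑ i, σ i k • e i
  have hF2 : ContDiff ℝ (2 : ℕ) F := hu.of_le (by norm_num)
  have hF1 : Differentiable ℝ F := hu.differentiable (by norm_num)
  obtain ⟨C, hC0, hC⟩ := exists_abs_integral_residual_le hξm hmean hcov hthird hfourth hu hubd
    (1, μ) b
  refine ⟨C, hC0, fun h hh t x ht htT => ?_⟩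
  have hgen : f t x (u t x) = fderiv ℝ F (t, x) (1, μ)
      + 1 / 2 * ∑ k, iteratedFDeriv ℝ 2 F (t, x) fun _ => b k := by
    have hdrift : ((1, μ) : ℝ × (Fin d → ℝ)) = (1, 0) + ∑ i, μ i • e i := by
      ext j <;> simp [e, Prod.fst_sum, Prod.snd_sum, Finset.sum_apply, Pi.single_apply]
    rw [← hpde t x ht (by linarith), deriv_fst_eq_fderiv hF1, hdrift, map_add, map_sum,
      sum_multilinear_two_col]
    have hvec : ∀ i j : Fin d, (fun l => ((0 : ℝ),
        (![Pi.single i 1, Pi.single j 1] : Fin 2 → Fin d → ℝ) l)) = ![e i, e j] := fun i j => by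
      ext l : 1; fin_cases l <;> rfl
    simp only [fderiv_snd_eq_fderiv hF1, iteratedFDeriv_snd_eq hF2, map_smul,
      smul_eq_mul, hvec]
    rfl
  have hpt : ∀ ω, (t + h, fun i => x i + μ i * h + √h * σ.mulVec (ξ ω) i)
      = (t, x) + √h • (∑ i, ξ ω i • b i) + h • ((1, μ) : ℝ × (Fin d → ℝ)) := fun ω => by
    ext j
    · simp [b, e, Prod.fst_sum]
    · simp [b, e, Prod.snd_sum, Finset.sum_apply, Pi.single_apply, Matrix.mulVec, dotProduct,
        mul_comm]
      ring
  have hmain := hC h hh (t, x)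
  rw [← hgen] at hmain
  simpa only [← hpt] using hmain
end

section
/- Let d ≥ 2, let c_{1,i}, c_{2,i} > 0 for i = 1,…,d−1, and define the Rosenbrock-type terminal function g(x) := log((1 + Σ_{i=1}^{d−1} [c_{1,i}(x_i − x_{i+1})² + c_{2,i} x_{i+1}²]) / 2) for x ∈ ℝ^d. Let γ_d denote the standard Gaussian measure on ℝ^d and define, for (t, x) ∈ [0, 1) × ℝ^d, u(t, x) := −½ log ( ∫_{ℝ^d} exp(−2 g(x − √(1 − t) y)) dγ_d(y) ). Then u is continuously differentiable in t and twice continuously differentiable in x on [0, 1) × ℝ^d, it solves the Hamilton–Jacobi–Bellman equation ∂_t u + ½ Δu − ‖∇u‖² = 0 on [0, 1) × ℝ^d, and for every x ∈ ℝ^d, u(t, x) → g(x) as t → 1⁻. -/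
open MeasureTheory ProbabilityTheory

theorem hasDerivAt_gaussianPDFReal_zero_one (x : ℝ) :
    HasDerivAt (gaussianPDFReal 0 1) (-(x * gaussianPDFReal 0 1 x)) x := by
  have h : HasDerivAt (fun y : ℝ => -(y - 0) ^ 2 / (2 * ((1 : NNReal) : ℝ))) (-x) x := by
    have := (((hasDerivAt_id x).sub_const 0).pow 2).neg.div_const (2 * ((1 : NNReal) : ℝ))
    refine this.congr_deriv ?_
    simp only [id, NNReal.coe_one]
    norm_num
    ring
  rw [gaussianPDFReal_def]
  refine (h.exp.const_mul _).congr_deriv ?_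
  ring

/-- **Stein's identity** for the standard Gaussian measure on `ℝ`. -/
theorem integral_mul_gaussianReal_eq_integral_deriv {f f' : ℝ → ℝ} {C : ℝ}
    (hf : ∀ x, HasDerivAt f (f' x) x) (hC : ∀ x, |f x| ≤ C) (hC' : ∀ x, |f' x| ≤ C) :
    ∫ x, x * f x ∂gaussianReal 0 1 = ∫ x, f' x ∂gaussianReal 0 1 := by
  have hf'_meas : Measurable f' := by
    rw [show f' = deriv f from funext fun x => (hf x).deriv.symm]
    exact measurable_deriv f
  have hf_meas : Measurable f :=
    (continuous_iff_continuousAt.2 fun x => (hf x).continuousAt).measurable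
  have hint : Integrable (fun x : ℝ => x * gaussianPDFReal 0 1 x) := by
    have h : Integrable (fun x : ℝ => x) (gaussianReal 0 1) :=
      (memLp_id_gaussianReal 1).integrable le_rfl
    rw [gaussianReal_of_var_ne_zero _ one_ne_zero, integrable_withDensity_iff
      (measurable_gaussianPDF _ _) (ae_of_all _ fun _ => gaussianPDF_lt_top)] at h
    simpa [toReal_gaussianPDF] using h
  have hφ := integrable_gaussianPDFReal 0 1
  rw [integral_gaussianReal_eq_integral_smul one_ne_zero,
    integral_gaussianReal_eq_integral_smul one_ne_zero]
  have key := integral_mul_deriv_eq_deriv_mul_of_integrable (u := f) (v := gaussianPDFReal 0 1)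
    (fun x _ => hf x) (fun x _ => hasDerivAt_gaussianPDFReal_zero_one x)
    (hint.neg.bdd_mul hf_meas.aestronglyMeasurable (ae_of_all _ hC))
    (hφ.bdd_mul hf'_meas.aestronglyMeasurable (ae_of_all _ hC'))
    (hφ.bdd_mul hf_meas.aestronglyMeasurable (ae_of_all _ hC))
  simp only [mul_neg, integral_neg, neg_inj] at key
  simp only [smul_eq_mul]
  calc _ = ∫ x, f x * (x * gaussianPDFReal 0 1 x) := by congr 1; ext x; ring
    _ = _ := key
    _ = _ := by congr 1; ext x; ring

theorem integrable_eval_pi_gaussianReal {d : ℕ} (i : Fin d) :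
    Integrable (fun y : Fin d → ℝ => y i) (Measure.pi fun _ : Fin d => gaussianReal 0 1) :=
  integrable_comp_eval (μ := fun _ : Fin d => gaussianReal 0 1) (i := i) (f := fun y : ℝ => y)
    ((memLp_id_gaussianReal 1).integrable le_rfl)

/-- **Stein's identity** for the standard Gaussian measure on `ℝ^d`. -/
theorem integral_eval_mul_pi_gaussianReal {d : ℕ} {f : (Fin d → ℝ) → ℝ}
    {f' : (Fin d → ℝ) → (Fin d → ℝ) →L[ℝ] ℝ} {C : ℝ}
    (hf : ∀ x, HasFDerivAt f (f' x) x) (hf' : Continuous f')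
    (hC : ∀ x, |f x| ≤ C) (i : Fin d) (hC' : ∀ x, |f' x (Pi.single i 1)| ≤ C) :
    ∫ y, y i * f y ∂(Measure.pi fun _ : Fin d => gaussianReal 0 1) =
      ∫ y, f' y (Pi.single i 1) ∂(Measure.pi fun _ : Fin d => gaussianReal 0 1) := by
  obtain _ | n := d
  · exact i.elim0
  have hf_cont : Continuous f := continuous_iff_continuousAt.2 fun x => (hf x).continuousAt
  have hmp := (measurePreserving_piFinSuccAbove
    (fun _ : Fin (n + 1) => gaussianReal 0 1) i).symm
  have h₁ : Integrable (fun y : Fin (n + 1) → ℝ => y i * f y)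
      (Measure.pi fun _ : Fin (n + 1) => gaussianReal 0 1) :=
    (integrable_eval_pi_gaussianReal i).mul_bdd hf_cont.aestronglyMeasurable (ae_of_all _ hC)
  have h₂ : Integrable (fun y : Fin (n + 1) → ℝ => f' y (Pi.single i 1))
      (Measure.pi fun _ : Fin (n + 1) => gaussianReal 0 1) :=
    .of_bound (hf'.clm_apply continuous_const).aestronglyMeasurable C (ae_of_all _ hC')
  rw [← hmp.integral_comp', ← hmp.integral_comp']
  refine (integral_prod_symm _
    ((hmp.integrable_comp_emb (MeasurableEquiv.measurableEmbedding _)).2 h₁)).trans (Eq.trans ?_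
      (integral_prod_symm _
        ((hmp.integrable_comp_emb (MeasurableEquiv.measurableEmbedding _)).2 h₂)).symm)
  congr 1
  ext y
  have hins (a : ℝ) : i.insertNth a y =
      i.insertNth 0 y + a • (Pi.single i 1 : Fin (n + 1) → ℝ) := by
    ext j
    induction j using Fin.succAboveCases i <;> simp
  have hd (a : ℝ) : HasDerivAt (fun a : ℝ => f (i.insertNth a y))
      (f' (i.insertNth a y) (Pi.single i 1)) a := by
    refine (hf _).comp_hasDerivAt a ?_
    rw [funext hins]
    simpa using ((hasDerivAt_id a).smul_const (Pi.single i 1 : Fin (n + 1) → ℝ)).const_add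
      (i.insertNth 0 y)
  have he (a : ℝ) : (MeasurableEquiv.piFinSuccAbove (fun _ : Fin (n + 1) => ℝ) i).symm (a, y) =
      i.insertNth a y := rfl
  simpa only [Function.comp_apply, he, Fin.insertNth_apply_same] using
    integral_mul_gaussianReal_eq_integral_deriv hd (fun a => hC _) (fun a => hC' _)

/-- Differentiation in space of the average of `f` over a translated and dilated measure. -/
theorem hasFDerivAt_integral_sub_smul {E V : Type*} [NormedAddCommGroup E] [NormedSpace ℝ E]
    [FiniteDimensional ℝ E] [MeasurableSpace E] [BorelSpace E]
    [NormedAddCommGroup V] [NormedSpace ℝ V] [FiniteDimensional ℝ V]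
    (μ : Measure E) [IsFiniteMeasure μ] {f : E → V} {f' : E → E →L[ℝ] V} {C : ℝ}
    (hf : ∀ x, HasFDerivAt f (f' x) x) (hf' : Continuous f')
    (hC : ∀ x, ‖f x‖ ≤ C) (hC' : ∀ x, ‖f' x‖ ≤ C) (r : ℝ) (x : E) :
    HasFDerivAt (fun x => ∫ y, f (x - r • y) ∂μ) (∫ y, f' (x - r • y) ∂μ) x := by
  have hf_cont : Continuous f := continuous_iff_continuousAt.2 fun x => (hf x).continuousAt
  refine hasFDerivAt_integral_of_dominated_of_fderiv_le
    (F' := fun x y => f' (x - r • y)) (bound := fun _ => C) Filter.univ_mem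
    (.of_forall fun x => (hf_cont.comp (by fun_prop)).aestronglyMeasurable)
    (.of_bound (hf_cont.comp (by fun_prop)).aestronglyMeasurable C (ae_of_all _ fun _ => hC _))
    (hf'.comp (by fun_prop)).aestronglyMeasurable
    (ae_of_all _ fun _ _ _ => hC' _) (integrable_const C)
    (ae_of_all _ fun y x _ => ?_)
  exact (hf (x - r • y)).comp x ((hasFDerivAt_id x).sub_const (r • y))

/-- Joint continuity of the average of `f` over a translated and dilated measure. -/
theorem continuous_integral_sub_smul {E V : Type*} [NormedAddCommGroup E] [NormedSpace ℝ E]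
    [FiniteDimensional ℝ E] [MeasurableSpace E] [BorelSpace E]
    [NormedAddCommGroup V] [NormedSpace ℝ V] [FiniteDimensional ℝ V]
    (μ : Measure E) [IsFiniteMeasure μ] {f : E → V} {C : ℝ}
    (hf : Continuous f) (hC : ∀ x, ‖f x‖ ≤ C) :
    Continuous fun p : ℝ × E => ∫ y, f (p.2 - p.1 • y) ∂μ :=
  continuous_of_dominated (bound := fun _ => C)
    (fun p => (hf.comp (by fun_prop)).aestronglyMeasurable)
    (fun p => ae_of_all _ fun _ => hC _) (integrable_const C)
    (ae_of_all _ fun y => hf.comp (by fun_prop))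

set_option maxSynthPendingDepth 5 in
/-- The Gaussian average of a function with bounded derivatives solves the heat equation. -/
theorem hasDerivAt_integral_sub_sqrt_smul {d : ℕ} {f : (Fin d → ℝ) → ℝ}
    {f' : (Fin d → ℝ) → (Fin d → ℝ) →L[ℝ] ℝ}
    {f'' : (Fin d → ℝ) → (Fin d → ℝ) →L[ℝ] (Fin d → ℝ) →L[ℝ] ℝ} {C : ℝ}
    (hf : ∀ x, HasFDerivAt f (f' x) x) (hf' : ∀ x, HasFDerivAt f' (f'' x) x)
    (hf'' : Continuous f'') (hC : ∀ x, ‖f x‖ ≤ C) (hC' : ∀ x, ‖f' x‖ ≤ C)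
    (hC'' : ∀ x, ‖f'' x‖ ≤ C) {s : ℝ} (hs : 0 < s) (x : Fin d → ℝ) :
    HasDerivAt (fun s => ∫ y, f (x - √s • y) ∂(Measure.pi fun _ : Fin d => gaussianReal 0 1))
      ((1 / 2) * ∑ i, (∫ y, f'' (x - √s • y) ∂(Measure.pi fun _ : Fin d => gaussianReal 0 1))
        (Pi.single i 1) (Pi.single i 1)) s := by
  set γ := Measure.pi fun _ : Fin d => gaussianReal 0 1
  have hf_cont : Continuous f := continuous_iff_continuousAt.2 fun x => (hf x).continuousAt
  have hf'_cont : Continuous f' := continuous_iff_continuousAt.2 fun x => (hf' x).continuousAt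
  have hC0 : 0 ≤ C := (norm_nonneg _).trans (hC 0)
  have hsum : Integrable (fun y : Fin d → ℝ => ∑ i, |y i|) γ :=
    integrable_finsetSum _ fun i _ => (integrable_eval_pi_gaussianReal i).abs
  have hnorm (y : Fin d → ℝ) : ‖y‖ ≤ ∑ i, |y i| :=
    (pi_norm_le_iff_of_nonneg (by positivity)).2 fun i =>
      Finset.single_le_sum (f := fun i => |y i|) (fun _ _ => abs_nonneg _) (Finset.mem_univ i)
  have hderiv := (hasDerivAt_integral_of_dominated_loc_of_deriv_le (μ := γ) (𝕜 := ℝ)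
    (F := fun s y => f (x - √s • y))
    (F' := fun s y => f' (x - √s • y) (-((1 / (2 * √s)) • y)))
    (bound := fun y => C * ((1 / (2 * √(s / 2))) * ∑ i, |y i|))
    (Ioi_mem_nhds (half_lt_self hs))
    (.of_forall fun s => (hf_cont.comp (by fun_prop)).aestronglyMeasurable)
    (.of_bound (hf_cont.comp (by fun_prop)).aestronglyMeasurable C (ae_of_all _ fun _ => hC _))
    ((hf'_cont.comp (by fun_prop)).clm_apply (by fun_prop)).aestronglyMeasurable
    (ae_of_all _ fun y t ht => ?_) ((hsum.const_mul _).const_mul _)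
    (ae_of_all _ fun y t ht => ?_)).2
  · refine hderiv.congr_deriv ?_
    have hII : Integrable (fun y => f'' (x - √s • y)) γ :=
      .of_bound (hf''.comp (by fun_prop)).aestronglyMeasurable C (ae_of_all _ fun _ => hC'' _)
    have hI (i : Fin d) : Integrable (fun y => y i * f' (x - √s • y) (Pi.single i 1)) γ := by
      refine (integrable_eval_pi_gaussianReal i).mul_bdd (c := C)
        ((hf'_cont.comp (by fun_prop)).clm_apply continuous_const).aestronglyMeasurable
        (ae_of_all _ fun y => ?_)
      simpa [Pi.norm_single] using (f' (x - √s • y)).le_of_opNorm_le (hC' _) (Pi.single i 1)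
    have hstein (i : Fin d) : ∫ y, y i * f' (x - √s • y) (Pi.single i 1) ∂γ =
        -√s * ∫ y, f'' (x - √s • y) (Pi.single i 1) (Pi.single i 1) ∂γ := by
      rw [← integral_const_mul]
      refine (integral_eval_mul_pi_gaussianReal (C := max C (√s * C))
        (f' := fun y => (-√s) • (f'' (x - √s • y)).flip (Pi.single i 1))
        (fun y => ?_) ?_ (fun y => ?_) i fun y => ?_).trans ?_
      · have h₁ : HasFDerivAt (fun y : Fin d → ℝ => x - √s • y)
            (-(√s • ContinuousLinearMap.id ℝ (Fin d → ℝ))) y :=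
          ((hasFDerivAt_id y).const_smul √s).const_sub x
        refine (((hf' _).comp y h₁).clm_apply
          (hasFDerivAt_const (Pi.single i 1 : Fin d → ℝ) y)).congr_fderiv ?_
        ext v
        simp
      · have h : Continuous fun y => f'' (x - √s • y) := hf''.comp (by fun_prop)
        have h' := (ContinuousLinearMap.flipₗᵢ ℝ (Fin d → ℝ) (Fin d → ℝ) ℝ).continuous.comp h
        exact (h'.clm_apply (continuous_const (y := Pi.single i 1))).const_smul (-√s)
      · refine le_trans ?_ (le_max_left _ _)
        simpa [Pi.norm_single] using (f' (x - √s • y)).le_of_opNorm_le (hC' _) (Pi.single i 1)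
      · refine le_trans ?_ (le_max_right _ _)
        have := (f'' (x - √s • y)).le_of_opNorm₂_le_of_le (x := Pi.single i 1)
          (y := Pi.single i 1) (hC'' _) (b := 1) (c := 1) (by simp [Pi.norm_single])
          (by simp [Pi.norm_single])
        simp only [mul_one, Real.norm_eq_abs] at this
        simp [abs_mul, abs_of_nonneg (Real.sqrt_nonneg s)]
        gcongr
      · simp [γ]
    have hexp (y : Fin d → ℝ) : f' (x - √s • y) (-((1 / (2 * √s)) • y)) =
        -(1 / (2 * √s)) * ∑ i, y i * f' (x - √s • y) (Pi.single i 1) := by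
      have h := congrArg (f' (x - √s • y)) (pi_eq_sum_univ' y)
      simp only [map_sum, map_smul, smul_eq_mul] at h
      rw [map_neg, map_smul, h, smul_eq_mul, neg_mul]
    simp_rw [hexp]
    rw [integral_const_mul, integral_finsetSum _ fun i _ => hI i]
    simp_rw [hstein]
    have happ (i : Fin d) : (∫ y, f'' (x - √s • y) ∂γ) (Pi.single i 1) (Pi.single i 1) =
        ∫ y, f'' (x - √s • y) (Pi.single i 1) (Pi.single i 1) ∂γ := by
      rw [ContinuousLinearMap.integral_apply hII, ContinuousLinearMap.integral_apply]
      exact hII.apply_continuousLinearMap _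
    simp_rw [happ, ← Finset.mul_sum]
    have := (Real.sqrt_pos.2 hs).ne'
    field_simp
  · refine ((f' _).le_of_opNorm_le (hC' _) _).trans ?_
    have : √(s / 2) ≤ √t := Real.sqrt_le_sqrt (le_of_lt ht)
    have h0 : 0 < √(s / 2) := Real.sqrt_pos.2 (by positivity)
    rw [norm_neg, norm_smul, Real.norm_of_nonneg (by positivity)]
    gcongr
    exact hnorm y
  · have ht0 : t ≠ 0 := ((half_pos hs).trans ht).ne'
    refine (hf _).comp_hasDerivAt t ?_
    exact ((Real.hasDerivAt_sqrt ht0).smul_const y).const_sub x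

set_option maxSynthPendingDepth 5 in
/-- The Cole–Hopf transform of a positive terminal datum with bounded derivatives solves the
Hamilton–Jacobi–Bellman equation. -/
theorem hjb_of_bounded_derivatives {d : ℕ} {f : (Fin d → ℝ) → ℝ}
    {f' : (Fin d → ℝ) → (Fin d → ℝ) →L[ℝ] ℝ}
    {f'' : (Fin d → ℝ) → (Fin d → ℝ) →L[ℝ] (Fin d → ℝ) →L[ℝ] ℝ} {C : ℝ}
    (hf : ∀ x, HasFDerivAt f (f' x) x) (hf' : ∀ x, HasFDerivAt f' (f'' x) x)
    (hf'' : Continuous f'') (hpos : ∀ x, 0 < f x) (hC : ∀ x, ‖f x‖ ≤ C) (hC' : ∀ x, ‖f' x‖ ≤ C)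
    (hC'' : ∀ x, ‖f'' x‖ ≤ C) :
    let u : ℝ → (Fin d → ℝ) → ℝ := fun t x => -(1 / 2) * Real.log
      (∫ y, f (x - √(1 - t) • y) ∂(Measure.pi fun _ : Fin d => gaussianReal 0 1))
    (∀ t ∈ Set.Ico (0 : ℝ) 1, ∀ x : Fin d → ℝ,
      ContDiffAt ℝ 1 (fun s => u s x) t ∧ ContDiffAt ℝ 2 (fun y => u t y) x) ∧
    (∀ t ∈ Set.Ico (0 : ℝ) 1, ∀ x : Fin d → ℝ,
      deriv (fun s => u s x) t
        + (1 / 2) * ∑ i, iteratedFDeriv ℝ 2 (fun y => u t y) x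
            ![Pi.single i 1, Pi.single i 1]
        - ∑ i, (fderiv ℝ (fun y => u t y) x (Pi.single i 1)) ^ 2 = 0) ∧
    (∀ x : Fin d → ℝ,
      Filter.Tendsto (fun t => u t x) (nhdsWithin 1 (Set.Iio 1))
        (nhds (-(1 / 2) * Real.log (f x)))) := by
  intro u
  set γ := Measure.pi fun _ : Fin d => gaussianReal 0 1
  have hf_cont : Continuous f := continuous_iff_continuousAt.2 fun x => (hf x).continuousAt
  have hf'_cont : Continuous f' := continuous_iff_continuousAt.2 fun x => (hf' x).continuousAt
  set F : ℝ → (Fin d → ℝ) → ℝ := fun r x => ∫ y, f (x - r • y) ∂γ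
  set F' : ℝ → (Fin d → ℝ) → (Fin d → ℝ) →L[ℝ] ℝ := fun r x => ∫ y, f' (x - r • y) ∂γ
  set F'' : ℝ → (Fin d → ℝ) → (Fin d → ℝ) →L[ℝ] (Fin d → ℝ) →L[ℝ] ℝ :=
    fun r x => ∫ y, f'' (x - r • y) ∂γ
  have hFpos (r : ℝ) (x : Fin d → ℝ) : 0 < F r x := by
    refine (integral_pos_iff_support_of_nonneg (fun y => (hpos _).le) ?_).2 ?_
    · exact .of_bound (hf_cont.comp (by fun_prop)).aestronglyMeasurable C
        (ae_of_all _ fun _ => hC _)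
    · rw [Function.support_eq_univ fun y => (hpos _).ne']
      simp
  have hF_cont : Continuous fun p : ℝ × (Fin d → ℝ) => F p.1 p.2 :=
    continuous_integral_sub_smul γ hf_cont hC
  have hF'_cont : Continuous fun p : ℝ × (Fin d → ℝ) => F' p.1 p.2 :=
    continuous_integral_sub_smul γ hf'_cont hC'
  have hF''_cont : Continuous fun p : ℝ × (Fin d → ℝ) => F'' p.1 p.2 :=
    continuous_integral_sub_smul γ hf'' hC''
  have hdF (r : ℝ) (x : Fin d → ℝ) : HasFDerivAt (F r) (F' r x) x :=
    hasFDerivAt_integral_sub_smul γ hf hf'_cont hC hC' r x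
  have hdF' (r : ℝ) (x : Fin d → ℝ) : HasFDerivAt (F' r) (F'' r x) x :=
    hasFDerivAt_integral_sub_smul γ hf' hf'' hC' hC'' r x
  have hF_contDiff (r : ℝ) : ContDiff ℝ 2 (F r) := by
    rw [show (2 : WithTop ℕ∞) = (1 : ℕ) + 1 by norm_num, contDiff_succ_iff_hasFDerivAt]
    refine ⟨F' r, ?_, hdF r⟩
    rw [Nat.cast_one, contDiff_one_iff_hasFDerivAt]
    exact ⟨F'' r, hF''_cont.comp (by fun_prop : Continuous fun x : Fin d → ℝ => (r, x)), hdF' r⟩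
  have hdt (x : Fin d → ℝ) {t : ℝ} (ht : t < 1) : HasDerivAt (fun s => F √(1 - s) x)
      (-((1 / 2) * ∑ i, F'' √(1 - t) x (Pi.single i 1) (Pi.single i 1))) t := by
    have h := hasDerivAt_integral_sub_sqrt_smul hf hf' hf'' hC hC' hC'' (sub_pos.2 ht) x
    refine (h.comp t ((hasDerivAt_id t).const_sub 1)).congr_deriv ?_
    rw [mul_neg_one]
  have hFt_contDiff (x : Fin d → ℝ) {t : ℝ} (ht : t < 1) :
      ContDiffAt ℝ 1 (fun s => F √(1 - s) x) t := by
    refine contDiffAt_one_iff.2 ⟨_, Set.Iio 1, Iio_mem_nhds ht, ?_,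
      fun s hs => (hdt x hs).hasFDerivAt⟩
    refine Continuous.continuousOn ?_
    have h : Continuous fun s : ℝ => F'' √(1 - s) x :=
      hF''_cont.comp (by fun_prop : Continuous fun s : ℝ => (√(1 - s), x))
    have h' : Continuous fun s : ℝ =>
        -((1 / 2) * ∑ i, F'' √(1 - s) x (Pi.single i 1) (Pi.single i 1)) := by
      refine (continuous_const.mul (continuous_finsetSum _ fun i _ => ?_)).neg
      exact (h.clm_apply continuous_const).clm_apply continuous_const
    exact (ContinuousLinearMap.toSpanSingletonCLE (𝕜 := ℝ) (E := ℝ)).continuous.comp h'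
  have hu' (t : ℝ) (x : Fin d → ℝ) :
      HasFDerivAt (u t) (-(1 / 2 : ℝ) • ((F √(1 - t) x)⁻¹ • F' √(1 - t) x)) x :=
    ((hdF _ x).log (hFpos _ _).ne').const_mul _
  have hu'' (t : ℝ) (x : Fin d → ℝ) : HasFDerivAt (fderiv ℝ (u t))
      (-(1 / 2 : ℝ) • ((F √(1 - t) x)⁻¹ • F'' √(1 - t) x +
        (-(F √(1 - t) x ^ 2)⁻¹ • F' √(1 - t) x).smulRight (F' √(1 - t) x))) x := by
    rw [show fderiv ℝ (u t) = fun x => -(1 / 2 : ℝ) • ((F √(1 - t) x)⁻¹ • F' √(1 - t) x) from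
      funext fun x => (hu' t x).fderiv]
    exact (((hasDerivAt_inv (hFpos _ _).ne').comp_hasFDerivAt x (hdF _ x)).smul
      (hdF' _ x)).const_smul (-(1 / 2 : ℝ))
  refine ⟨fun t ht x => ⟨?_, ?_⟩, fun t ht x => ?_, fun x => ?_⟩
  · exact contDiffAt_const.mul ((hFt_contDiff x ht.2).log (hFpos _ _).ne')
  · exact contDiffAt_const.mul ((hF_contDiff _).contDiffAt.log (hFpos _ _).ne')
  · have hut : HasDerivAt (fun s => u s x) _ t :=
      ((hdt x ht.2).log (hFpos _ _).ne').const_mul (-(1 / 2))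
    rw [hut.deriv]
    simp only [iteratedFDeriv_two_apply, (hu'' t x).fderiv, (hu' t x).fderiv]
    have hne := (hFpos √(1 - t) x).ne'
    simp only [Matrix.cons_val_zero, Matrix.cons_val_one, smul_apply, add_apply, ContinuousLinearMap.smulRight_apply, smul_eq_mul]
    have e₁ : ∑ i, -(1 / 2) * ((F √(1 - t) x)⁻¹ * F'' √(1 - t) x (Pi.single i 1) (Pi.single i 1) +
        -(F √(1 - t) x ^ 2)⁻¹ * F' √(1 - t) x (Pi.single i 1) * F' √(1 - t) x (Pi.single i 1)) =
        -(1 / 2) * (F √(1 - t) x)⁻¹ * ∑ i, F'' √(1 - t) x (Pi.single i 1) (Pi.single i 1) +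
        (1 / 2) * (F √(1 - t) x ^ 2)⁻¹ * ∑ i, (F' √(1 - t) x (Pi.single i 1)) ^ 2 := by
      rw [Finset.mul_sum, Finset.mul_sum, ← Finset.sum_add_distrib]
      exact Finset.sum_congr rfl fun i _ => by ring
    have e₂ : ∑ i, (-(1 / 2) * ((F √(1 - t) x)⁻¹ * F' √(1 - t) x (Pi.single i 1))) ^ 2 =
        (1 / 4) * (F √(1 - t) x ^ 2)⁻¹ * ∑ i, (F' √(1 - t) x (Pi.single i 1)) ^ 2 := by
      rw [Finset.mul_sum]
      exact Finset.sum_congr rfl fun i _ => by ring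
    rw [e₁, e₂]
    ring
  · have h : Continuous fun t => u t x :=
      continuous_const.mul ((hF_cont.comp
        (by fun_prop : Continuous fun s : ℝ => (√(1 - s), x))).log fun s => (hFpos _ _).ne')
    refine Filter.Tendsto.mono_left (h.tendsto' 1 _ ?_) nhdsWithin_le_nhds
    simp [u]

set_option maxSynthPendingDepth 5 in
/-- The function `4 / (1 + ∑ j, (ℓ j x) ^ 2) ^ 2` has bounded derivatives up to order two. -/
theorem exists_bounded_derivatives_inv_one_add_sum_sq {d : ℕ} {ι : Type*} [Fintype ι]
    (ℓ : ι → (Fin d → ℝ) →L[ℝ] ℝ) :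
    ∃ (f' : (Fin d → ℝ) → (Fin d → ℝ) →L[ℝ] ℝ)
      (f'' : (Fin d → ℝ) → (Fin d → ℝ) →L[ℝ] (Fin d → ℝ) →L[ℝ] ℝ) (C : ℝ),
      (∀ x, HasFDerivAt (fun x => 4 * (1 + ∑ j, ℓ j x ^ 2)⁻¹ ^ 2) (f' x) x) ∧
      (∀ x, HasFDerivAt f' (f'' x) x) ∧ Continuous f'' ∧
      (∀ x, ‖4 * (1 + ∑ j, ℓ j x ^ 2)⁻¹ ^ 2‖ ≤ C) ∧ (∀ x, ‖f' x‖ ≤ C) ∧ ∀ x, ‖f'' x‖ ≤ C := by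
  set q : (Fin d → ℝ) → ℝ := fun x => 1 + ∑ j, ℓ j x ^ 2 with hq
  set p : (Fin d → ℝ) → ℝ := fun x => (q x)⁻¹ with hp
  set q' : (Fin d → ℝ) → (Fin d → ℝ) →L[ℝ] ℝ := fun x => ∑ j, (2 * ℓ j x) • ℓ j with hq'
  have hq1 (x : Fin d → ℝ) : 1 ≤ q x := le_add_of_nonneg_right (by positivity)
  have hqpos (x : Fin d → ℝ) : 0 < q x := one_pos.trans_le (hq1 x)
  have hppos (x : Fin d → ℝ) : 0 < p x := inv_pos.2 (hqpos x)
  have hp1 (x : Fin d → ℝ) : p x ≤ 1 := inv_le_one_of_one_le₀ (hq1 x)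
  have hpℓ (j : ι) (x : Fin d → ℝ) : p x * |ℓ j x| ≤ 1 := by
    rw [hp, inv_mul_le_one₀ (hqpos x)]
    have h1 : ℓ j x ^ 2 ≤ ∑ j, ℓ j x ^ 2 :=
      Finset.single_le_sum (f := fun j => ℓ j x ^ 2) (fun _ _ => sq_nonneg _) (Finset.mem_univ j)
    have h2 : |ℓ j x| ≤ 1 + ℓ j x ^ 2 := by
      rw [← sq_abs]; nlinarith [sq_nonneg (|ℓ j x| - 1), sq_nonneg (|ℓ j x|)]
    exact h2.trans (by simp only [hq]; linarith)
  have hdq (x : Fin d → ℝ) : HasFDerivAt q (q' x) x := by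
    refine (HasFDerivAt.fun_sum fun j _ => ((ℓ j).hasFDerivAt.pow 2)).const_add 1 |>.congr_fderiv ?_
    simp [hq']
  have hdp (x : Fin d → ℝ) : HasFDerivAt p (-(p x ^ 2) • q' x) x :=
    ((hasDerivAt_inv (hqpos x).ne').comp_hasFDerivAt x (hdq x)).congr_fderiv (by simp only [hp, inv_pow])
  have hp_cont : Continuous p := continuous_iff_continuousAt.2 fun x => (hdp x).continuousAt
  have hq'_cont : Continuous q' := by fun_prop
  obtain ⟨L, hL⟩ : ∃ L : ℝ, L = ∑ j, ‖ℓ j‖ := ⟨_, rfl⟩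
  have hL0 : 0 ≤ L := hL ▸ by positivity
  have hpq' (x : Fin d → ℝ) : p x * ‖q' x‖ ≤ 2 * L := by
    have h : ‖q' x‖ ≤ ∑ j, 2 * |ℓ j x| * ‖ℓ j‖ := by
      refine (norm_sum_le _ _).trans_eq (Finset.sum_congr rfl fun j _ => ?_)
      simp [norm_smul]
    refine (mul_le_mul_of_nonneg_left h (hppos x).le).trans ?_
    rw [hL, Finset.mul_sum, Finset.mul_sum]
    refine Finset.sum_le_sum fun j _ => ?_
    nlinarith [mul_le_mul_of_nonneg_right (hpℓ j x) (norm_nonneg (ℓ j))]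
  set B : (Fin d → ℝ) →L[ℝ] (Fin d → ℝ) →L[ℝ] ℝ := ∑ j, (ℓ j).smulRight ((2 : ℝ) • ℓ j) with hB
  have hdq' (x : Fin d → ℝ) : HasFDerivAt q' B x := by
    have : q' = B := by
      ext x v
      simp [hq', hB, mul_assoc, mul_left_comm]
    rw [this]
    exact B.hasFDerivAt
  refine ⟨fun x => (-8 * p x ^ 3) • q' x, fun x => (-8 * p x ^ 3) • B +
    ((24 * p x ^ 4) • q' x).smulRight (q' x), 4 + 16 * L + 8 * ‖B‖ + 96 * L ^ 2,
    fun x => ?_, fun x => ?_, ?_, fun x => ?_, fun x => ?_, fun x => ?_⟩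
  · refine (((hdp x).pow 2).const_mul 4).congr_fderiv ?_
    ext v
    simp
    ring
  · refine ((((hdp x).pow 3).const_mul (-8)).smul (hdq' x)).congr_fderiv ?_
    ext v w
    simp only [smul_apply, add_apply, ContinuousLinearMap.smulRight_apply, smul_eq_mul]
    ring
  · have h : Continuous fun x =>
        ContinuousLinearMap.smulRightL ℝ (Fin d → ℝ) _ ((24 * p x ^ 4) • q' x) (q' x) := by
      fun_prop
    exact (by fun_prop : Continuous fun x => (-8 * p x ^ 3) • B).add h
  · rw [Real.norm_of_nonneg (mul_nonneg (by norm_num) (sq_nonneg _))]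
    have := pow_le_one₀ (n := 2) (hppos x).le (hp1 x)
    have : 0 ≤ ‖B‖ := norm_nonneg B
    nlinarith [sq_nonneg L]
  · have h : p x ^ 3 * ‖q' x‖ ≤ p x * ‖q' x‖ := by
      gcongr
      exact pow_le_of_le_one (hppos x).le (hp1 x) (by norm_num)
    rw [norm_smul, norm_mul, norm_pow, Real.norm_of_nonneg (hppos x).le, norm_neg, Real.norm_ofNat]
    nlinarith [hpq' x, norm_nonneg B, sq_nonneg L]
  · have h₁ : p x ^ 3 * ‖B‖ ≤ ‖B‖ :=
      mul_le_of_le_one_left (norm_nonneg B) (pow_le_one₀ (hppos x).le (hp1 x))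
    have h₂ : p x ^ 4 * ‖q' x‖ ^ 2 ≤ (2 * L) ^ 2 := by
      refine le_trans ?_ (pow_le_pow_left₀ (by have := hppos x; positivity) (hpq' x) 2)
      rw [mul_pow]
      gcongr ?_ * _
      exact pow_le_pow_of_le_one (hppos x).le (hp1 x) (by norm_num)
    refine (norm_add_le ((-8 * p x ^ 3) • B) (((24 * p x ^ 4) • q' x).smulRight (q' x))).trans ?_
    rw [norm_smul, ContinuousLinearMap.norm_smulRight_apply, norm_smul, norm_mul, norm_mul,
      norm_pow, norm_pow, Real.norm_of_nonneg (hppos x).le, norm_neg, Real.norm_ofNat,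
      Real.norm_ofNat]
    nlinarith

/-- Cole–Hopf solution of the HJB equation with Rosenbrock-type terminal data: with
`g(x) = log((1 + Σ_{i=1}^{d−1} [c_{1,i}(x_i − x_{i+1})² + c_{2,i} x_{i+1}²])/2)` and
`u(t,x) = −½ log ∫ exp(−2 g(x − √(1−t) y)) dγ_d(y)`, the function `u` is `C¹` in `t` and
`C²` in `x` on `[0,1) × ℝ^d`, solves `∂_t u + ½ Δu − ‖∇u‖² = 0` there, and
`u(t,x) → g(x)` as `t → 1⁻`. -/
theorem hjb_rosenbrock_solution {d : ℕ} (hd : 2 ≤ d)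
    (c₁ c₂ : Fin (d - 1) → ℝ) (hc₁ : ∀ i, 0 < c₁ i) (hc₂ : ∀ i, 0 < c₂ i) :
    let g : (Fin d → ℝ) → ℝ := fun x =>
      Real.log ((1 + ∑ i : Fin (d - 1),
        (c₁ i * (x ⟨i.1, by have := i.isLt; omega⟩ - x ⟨i.1 + 1, by have := i.isLt; omega⟩) ^ 2
          + c₂ i * (x ⟨i.1 + 1, by have := i.isLt; omega⟩) ^ 2)) / 2)
    let γ : Measure (Fin d → ℝ) := Measure.pi fun _ : Fin d => gaussianReal 0 1
    let u : ℝ → (Fin d → ℝ) → ℝ := fun t x =>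
      -(1 / 2) * Real.log (∫ y, Real.exp (-2 * g (x - Real.sqrt (1 - t) • y)) ∂γ)
    (∀ t ∈ Set.Ico (0 : ℝ) 1, ∀ x : Fin d → ℝ,
      ContDiffAt ℝ 1 (fun s => u s x) t ∧ ContDiffAt ℝ 2 (fun y => u t y) x) ∧
    (∀ t ∈ Set.Ico (0 : ℝ) 1, ∀ x : Fin d → ℝ,
      deriv (fun s => u s x) t
        + (1 / 2) * ∑ i, iteratedFDeriv ℝ 2 (fun y => u t y) x
            ![Pi.single i 1, Pi.single i 1]
        - ∑ i, (fderiv ℝ (fun y => u t y) x (Pi.single i 1)) ^ 2 = 0) ∧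
    (∀ x : Fin d → ℝ,
      Filter.Tendsto (fun t => u t x) (nhdsWithin 1 (Set.Iio 1)) (nhds (g x))) := by
  intro g γ u
  have hlt (i : Fin (d - 1)) : i.1 < d := by have := i.isLt; omega
  have hlt' (i : Fin (d - 1)) : i.1 + 1 < d := by have := i.isLt; omega
  let ℓ : Fin (d - 1) ⊕ Fin (d - 1) → (Fin d → ℝ) →L[ℝ] ℝ := Sum.elim
    (fun i => √(c₁ i) • (ContinuousLinearMap.proj ⟨i.1, hlt i⟩ -
      ContinuousLinearMap.proj ⟨i.1 + 1, hlt' i⟩))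
    (fun i => √(c₂ i) • ContinuousLinearMap.proj ⟨i.1 + 1, hlt' i⟩)
  have hsum (x : Fin d → ℝ) : ∑ j, ℓ j x ^ 2 = ∑ i : Fin (d - 1),
      (c₁ i * (x ⟨i.1, hlt i⟩ - x ⟨i.1 + 1, hlt' i⟩) ^ 2 + c₂ i * (x ⟨i.1 + 1, hlt' i⟩) ^ 2) := by
    simp [ℓ, Finset.sum_add_distrib, mul_pow, Real.sq_sqrt (hc₁ _).le, Real.sq_sqrt (hc₂ _).le]
  have hq (x : Fin d → ℝ) : 0 < 1 + ∑ j, ℓ j x ^ 2 := by positivity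
  have hexp (x : Fin d → ℝ) : Real.exp (-2 * g x) = 4 * (1 + ∑ j, ℓ j x ^ 2)⁻¹ ^ 2 := by
    have hg : g x = Real.log ((1 + ∑ j, ℓ j x ^ 2) / 2) := by simp only [g, hsum]
    have h := (hq x).ne'
    rw [hg, show ∀ a : ℝ, -2 * a = -(a + a) by intro a; ring, Real.exp_neg, Real.exp_add,
      Real.exp_log (by have := hq x; positivity)]
    field_simp
    norm_num
  obtain ⟨f', f'', C, hf, hf', hf'', hC, hC', hC''⟩ :=
    exists_bounded_derivatives_inv_one_add_sum_sq ℓ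
  have key := hjb_of_bounded_derivatives hf hf' hf''
    (fun x => by have := hq x; positivity) hC hC' hC''
  simp only [← hexp, Real.log_exp] at key
  refine ⟨key.1, key.2.1, fun x => ?_⟩
  convert! key.2.2 x using 2
  ring
end
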